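/- arXiv:1903.06942 — 7 statements merged into one kernel-verified Lean document; each statement's English description precedes it below -/
import Mathlib

section
/- Let A be the adjacency matrix over F2 of a simple graph on n vertices and N := A + I. Then an initial state i ∈ F2^n can be transformed into a final state f ∈ F2^n in the Lights Out game (i.e., there exists a ∈ F2^n with f = i + N a) if and only if ⟨i, v⟩ = ⟨f, v⟩ for every v ∈ ker N. In particular, all lights can be turned off starting from i if and only if ⟨i, v⟩ = 0 for every v ∈ ker N. -/
open Matrix

theorem lo_key (n : ℕ) (N : Matrix (Fin n) (Fin n) (ZMod 2)) (hs : Nᵀ = N)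
    (w : Fin n → ZMod 2) :
    (∃ a : Fin n → ZMod 2, w = N.mulVec a) ↔
      ∀ v : Fin n → ZMod 2, N.mulVec v = 0 → w ⬝ᵥ v = 0 := by
  constructor
  · rintro ⟨a, rfl⟩ v hv
    rw [dotProduct_comm, dotProduct_mulVec, ← mulVec_transpose, hs, hv, zero_dotProduct]
  · intro h
    by_contra hw
    have hw' : w ∉ LinearMap.range N.mulVecLin := by
      rintro ⟨a, ha⟩
      exact hw ⟨a, by simpa using ha.symm⟩
    obtain ⟨φ, hφ, hle⟩ := Submodule.exists_le_ker_of_notMem hw'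
    obtain ⟨v, rfl⟩ := (dotProductEquiv (ZMod 2) (Fin n)).surjective φ
    simp only [dotProductEquiv_apply_apply] at hφ
    apply hφ
    rw [dotProduct_comm]
    apply h
    apply dotProduct_eq_zero
    intro a
    have := hle ⟨a, rfl⟩
    simp only [LinearMap.mem_ker, dotProductEquiv_apply_apply, mulVecLin_apply] at this
    rwa [dotProduct_mulVec, ← mulVec_transpose, hs] at this

theorem lo_main (n : ℕ) (N : Matrix (Fin n) (Fin n) (ZMod 2)) (hs : Nᵀ = N)
    (i f : Fin n → ZMod 2) :
    (∃ a : Fin n → ZMod 2, f = i + N.mulVec a) ↔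
      ∀ v : Fin n → ZMod 2, N.mulVec v = 0 → ∑ j, i j * v j = ∑ j, f j * v j := by
  have := lo_key n N hs (f - i)
  simp only [sub_eq_iff_eq_add', sub_dotProduct, add_zero] at this
  rw [this]
  exact forall₂_congr fun v _ => eq_comm

/-- Separating invariant for the Lights Out game: with `N = A + I`, a state `i` can be
transformed into a state `f` iff `⟨i, v⟩ = ⟨f, v⟩` for all `v ∈ ker N`; in particular all
lights can be turned off starting from `i` iff `⟨i, v⟩ = 0` for all `v ∈ ker N`. -/
theorem lightsOut_separating_invariant (n : ℕ) (A : Matrix (Fin n) (Fin n) (ZMod 2))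
    (hsymm : A.IsSymm) (hdiag : ∀ i, A i i = 0) (N : Matrix (Fin n) (Fin n) (ZMod 2))
    (hN : N = A + 1) (i f : Fin n → ZMod 2) :
    ((∃ a : Fin n → ZMod 2, f = i + N.mulVec a) ↔
      ∀ v : Fin n → ZMod 2, N.mulVec v = 0 → ∑ j, i j * v j = ∑ j, f j * v j) ∧
    ((∃ a : Fin n → ZMod 2, (0 : Fin n → ZMod 2) = i + N.mulVec a) ↔
      ∀ v : Fin n → ZMod 2, N.mulVec v = 0 → ∑ j, i j * v j = 0) := by
  have hs : Nᵀ = N := by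
    rw [hN, transpose_add, hsymm.eq, transpose_one]
  refine ⟨lo_main n N hs i f, ?_⟩
  simpa using lo_main n N hs i 0
end

section
/- Let N be a symmetric n×n matrix over F2 with all diagonal entries equal to 1. Then every x ∈ ker N is isotropic, i.e., satisfies ⟨x, x⟩ = 0 (equivalently, the number of coordinates of x equal to 1 is even). -/
open Matrix

/-- If `N` is a symmetric matrix over 𝔽₂ with all diagonal entries equal to 1, then every
element of its kernel is isotropic. -/
theorem ker_isotropic_of_symm_diag_one (n : ℕ) (N : Matrix (Fin n) (Fin n) (ZMod 2))
    (hsymm : N.IsSymm) (hdiag : ∀ i, N i i = 1) (x : Fin n → ZMod 2)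
    (hx : N.mulVec x = 0) : ∑ i, x i * x i = 0 := by
  have h0 : ∑ i, ∑ j, x i * (N i j * x j) = 0 := by
    apply Finset.sum_eq_zero
    intro i _
    have h : ∑ j, N i j * x j = 0 := congrFun hx i
    rw [← Finset.mul_sum, h, mul_zero]
  have h1 : ∑ p : Fin n × Fin n,
      (x p.1 * (N p.1 p.2 * x p.2) - if p.1 = p.2 then x p.1 * x p.1 else 0) = 0 := by
    refine Finset.sum_involution (fun p _ => p.swap) ?_ ?_ ?_ ?_
    · rintro ⟨i, j⟩ _
      by_cases hij : i = j
      · subst hij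
        simp [hdiag]
      · have hs : N j i = N i j := hsymm.apply i j
        simp only [Prod.fst_swap, Prod.snd_swap, if_neg hij, if_neg (Ne.symm hij), hs, sub_zero]
        rw [show x j * (N i j * x i) = x i * (N i j * x j) by ring]
        exact CharTwo.add_self_eq_zero _
    · rintro ⟨i, j⟩ _ hne heq
      simp only [Prod.swap_prod_mk, Prod.mk.injEq] at heq
      apply hne
      obtain ⟨rfl, _⟩ := heq
      simp [hdiag]
    · intro a _
      exact Finset.mem_univ _
    · intro a _
      exact Prod.swap_swap a
  rw [Fintype.sum_prod_type] at h1
  simp only [Finset.sum_sub_distrib, h0] at h1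
  simpa using h1
end

section
/- Let A be the adjacency matrix over F2 of a simple graph on n vertices and N := A + I. Then the all-ones vector (1,1,…,1)ᵀ lies in the column space of N. Consequently, every state x ∈ F2^n of the Lights Out game can be transformed into its inverse state x̄ = x + (1,…,1)ᵀ. -/
open Matrix

theorem lightsOut_sq : ∀ z : ZMod 2, z * 1 = z * z := by decide

theorem lightsOut_aux (n : ℕ) (A : Matrix (Fin n) (Fin n) (ZMod 2))
    (hsymm : A.IsSymm) (hdiag : ∀ i, A i i = 0) (y : Fin n → ZMod 2) :
    y ⬝ᵥ A.mulVec y = 0 := by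
  have h : y ⬝ᵥ A.mulVec y = ∑ p : Fin n × Fin n, y p.1 * (A p.1 p.2 * y p.2) := by
    simp only [dotProduct, mulVec, Finset.mul_sum, Fintype.sum_prod_type]
  rw [h]
  refine Finset.sum_involution (fun p _ => p.swap) ?_ ?_ ?_ ?_
  · rintro ⟨i, j⟩ -
    simp only [Prod.fst_swap, Prod.snd_swap]
    rw [hsymm.apply i j]
    have : y j * (A i j * y i) = y i * (A i j * y j) := by ring
    rw [this]
    exact CharTwo.add_self_eq_zero _
  · rintro ⟨i, j⟩ - h0 h1
    simp only [Prod.swap_prod_mk, Prod.mk.injEq] at h1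
    obtain ⟨rfl, -⟩ := h1
    simp [hdiag] at h0
  · simp
  · simp

/-- The all-ones vector lies in the column space of `N = A + I`; consequently every state of
the Lights Out game can be transformed into its inverse state. -/
theorem lightsOut_invert_state (n : ℕ) (A : Matrix (Fin n) (Fin n) (ZMod 2))
    (hsymm : A.IsSymm) (hdiag : ∀ i, A i i = 0) (N : Matrix (Fin n) (Fin n) (ZMod 2))
    (hN : N = A + 1) :
    (∃ a : Fin n → ZMod 2, N.mulVec a = fun _ => 1) ∧
    (∀ x : Fin n → ZMod 2, ∃ a : Fin n → ZMod 2,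
      (x + fun _ => 1) = x + N.mulVec a) := by
  have key : ∃ a : Fin n → ZMod 2, N.mulVec a = fun _ => 1 := by
    change (fun _ => 1) ∈ LinearMap.range N.mulVecLin
    have : Fact (Nat.Prime 2) := ⟨Nat.prime_two⟩
    rw [← Subspace.forall_mem_dualAnnihilator_apply_eq_zero_iff]
    intro φ hφ
    rw [Submodule.mem_dualAnnihilator] at hφ
    obtain ⟨y, rfl⟩ := (dotProductEquiv (ZMod 2) (Fin n)).surjective φ
    have h1 : y ⬝ᵥ N.mulVec y = 0 := hφ (N.mulVec y) ⟨y, rfl⟩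
    rw [hN, add_mulVec, dotProduct_add, lightsOut_aux n A hsymm hdiag, zero_add, one_mulVec] at h1
    change y ⬝ᵥ (fun _ => 1) = 0
    rw [← h1]
    simp only [dotProduct]
    refine Finset.sum_congr rfl fun i _ => ?_
    exact lightsOut_sq (y i)
  refine ⟨key, fun x => ?_⟩
  obtain ⟨a, ha⟩ := key
  exact ⟨a, by rw [ha]⟩
end

section
/- Let A be the adjacency matrix over F2 of a simple graph on n vertices. If every vertex has even degree or zero degree, then the all-ones vector (1,…,1)ᵀ lies in the column space of A² + I; if every vertex has odd degree, then the all-ones vector lies in the column space of A². Hence every state in the Second Neighbors Lights Out game can be inverted. -/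
open Matrix

/-- In the Second Neighbors Lights Out game, the all-ones vector lies in the column space of
the game matrix (`A² + I` if all degrees are even or zero, `A²` if all degrees are odd);
hence every state can be inverted. -/
theorem secondNeighbors_invert_state (n : ℕ)
    (A : Matrix (Fin n) (Fin n) (ZMod 2)) (hsymm : A.IsSymm) (hdiag : ∀ i, A i i = 0) :
    ((∀ i, ∑ j, A i j = 0) →
      ∃ a : Fin n → ZMod 2, (A * A + 1).mulVec a = fun _ => 1) ∧
    ((∀ i, ∑ j, A i j = 1) →
      ∃ a : Fin n → ZMod 2, (A * A).mulVec a = fun _ => 1) := by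
  constructor
  · intro h
    refine ⟨fun _ => 1, ?_⟩
    have h1 : A.mulVec (fun _ => 1) = 0 := by
      funext i
      simpa [Matrix.mulVec, dotProduct] using h i
    rw [Matrix.add_mulVec, ← Matrix.mulVec_mulVec, h1, Matrix.mulVec_zero, Matrix.one_mulVec,
      zero_add]
  · intro h
    refine ⟨fun _ => 1, ?_⟩
    have h1 : A.mulVec (fun _ => 1) = fun _ => 1 := by
      funext i
      simpa [Matrix.mulVec, dotProduct] using h i
    rw [← Matrix.mulVec_mulVec, h1, h1]
end

section
/- Let A be the adjacency matrix over F2 of a simple graph on n vertices in which every vertex has odd degree, and set N̄ := A + A². Then all diagonal entries of A + A² + I are 0 (so A + A² + I is the adjacency matrix of a simple graph), and for states i, f ∈ F2^n there exists a ∈ F2^n with f = i + N̄ a (i.e., i can be transformed into f in the Neighborhood Lights Out game) if and only if ⟨i, v⟩ = ⟨f, v⟩ for every v ∈ ker N̄. -/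
open Matrix

/-- For a graph all of whose vertices have odd degree: `A + A² + I` has zero diagonal (so it
is the adjacency matrix of a simple graph), and the kernel of `N̄ = A + A²` yields a
separating invariant for the Neighborhood Lights Out game. -/
theorem neighborhood_separating_invariant_odd (n : ℕ)
    (A : Matrix (Fin n) (Fin n) (ZMod 2)) (hsymm : A.IsSymm) (hdiag : ∀ i, A i i = 0)
    (hdeg : ∀ i, ∑ j, A i j = 1)
    (Nbar : Matrix (Fin n) (Fin n) (ZMod 2)) (hNbar : Nbar = A + A * A) :
    (∀ i, (A + A * A + 1) i i = 0) ∧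
    (∀ i f : Fin n → ZMod 2,
      (∃ a : Fin n → ZMod 2, f = i + Nbar.mulVec a) ↔
        ∀ v : Fin n → ZMod 2, Nbar.mulVec v = 0 →
          ∑ j, i j * v j = ∑ j, f j * v j) := by
  have hN : Nbar.transpose = Nbar := by
    have h : A.transpose = A := hsymm
    rw [hNbar, Matrix.transpose_add, Matrix.transpose_mul, h]
  constructor
  · intro i
    have h2 : ∀ x : ZMod 2, x * x = x := by decide
    have h3 : (A * A) i i = 1 := by
      rw [Matrix.mul_apply, ← hdeg i]
      refine Finset.sum_congr rfl fun j _ => ?_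
      rw [hsymm.apply i j, h2]
    rw [Matrix.add_apply, Matrix.add_apply, h3, hdiag, Matrix.one_apply_eq]
    decide
  · intro i f
    constructor
    · rintro ⟨a, rfl⟩ v hv
      change i ⬝ᵥ v = (i + Nbar.mulVec a) ⬝ᵥ v
      have h : Nbar.mulVec a ⬝ᵥ v = 0 := by
        rw [dotProduct_comm, Matrix.dotProduct_mulVec, ← Matrix.mulVec_transpose, hN, hv,
          zero_dotProduct]
      rw [add_dotProduct, h, add_zero]
    · intro h
      have hmem : dotProductBilin (ZMod 2) (ZMod 2) (f - i) ∈
          LinearMap.range (Nbar.mulVecLin).dualMap := by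
        rw [LinearMap.range_dualMap_eq_dualAnnihilator_ker, Submodule.mem_dualAnnihilator]
        intro v hv
        have := h v (by simpa using hv)
        change (f - i) ⬝ᵥ v = 0
        rw [sub_dotProduct, sub_eq_zero]
        exact this.symm
      obtain ⟨g, hg⟩ := hmem
      refine ⟨fun j => g (Pi.single j 1), ?_⟩
      have hgv : ∀ w : Fin n → ZMod 2, g w = (fun j => g (Pi.single j 1)) ⬝ᵥ w := by
        intro w
        rw [LinearMap.pi_apply_eq_sum_univ g w]
        simp only [dotProduct, smul_eq_mul]
        refine Finset.sum_congr rfl fun j _ => ?_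
        rw [mul_comm]
        congr 2
        ext k
        simp [Pi.single_apply, eq_comm]
      rw [← sub_eq_iff_eq_add']
      apply dotProduct_eq
      intro v
      have h1 := LinearMap.congr_fun hg v
      change g (Nbar.mulVec v) = (f - i) ⬝ᵥ v at h1
      rw [← h1, hgv, Matrix.dotProduct_mulVec, ← Matrix.mulVec_transpose, hN]
end

section
/- Let A be the adjacency matrix over F2 of a simple graph on n vertices. If every vertex has odd degree, then the all-ones vector (1,…,1)ᵀ lies in the column space of A + A²; if every vertex has even degree or zero degree, then the all-ones vector lies in the column space of A + A² + I. Hence every state in the Neighborhood Lights Out game can be inverted. -/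
open Matrix

theorem sum_sum_symm_zmod2 {n : ℕ} (g : Fin n → Fin n → ZMod 2) (hg : ∀ i j, g i j = g j i)
    (s : Finset (Fin n)) : ∑ i ∈ s, ∑ j ∈ s, g i j = ∑ i ∈ s, g i i := by
  classical
  induction s using Finset.induction_on with
  | empty => simp
  | insert a s ha ih =>
    simp only [Finset.sum_insert ha, Finset.sum_add_distrib]
    rw [ih, Finset.sum_congr rfl (fun i _ => hg i a)]
    have := CharTwo.add_self_eq_zero (∑ j ∈ s, g a j)
    linear_combination this

theorem ones_mem_zmod2 {n : ℕ} (M : Matrix (Fin n) (Fin n) (ZMod 2)) (hM : M.IsSymm)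
    (hd : ∀ i, M i i = 1) : ∃ a : Fin n → ZMod 2, M.mulVec a = fun _ => 1 := by
  by_contra hne
  have hnm : (fun _ => 1 : Fin n → ZMod 2) ∉ LinearMap.range M.mulVecLin := by
    rintro ⟨a, ha⟩
    exact hne ⟨a, by simpa using ha⟩
  obtain ⟨f, hf, hle⟩ := Submodule.exists_le_ker_of_notMem hnm
  have hrep : ∀ x : Fin n → ZMod 2, f x = ∑ i, x i * f (Pi.single i 1) := by
    intro x
    conv_lhs => rw [pi_eq_sum_univ' x]
    simp [map_sum]
  set y : Fin n → ZMod 2 := fun i => f (Pi.single i 1) with hy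
  apply hf
  have h0 : f (M.mulVec y) = 0 := by
    have : M.mulVec y ∈ LinearMap.range M.mulVecLin := ⟨y, by simp⟩
    simpa using hle this
  rw [hrep] at h0 ⊢
  have hs := sum_sum_symm_zmod2 (fun i j => M i j * y j * y i)
    (fun i j => by rw [hM.apply i j]; ring) Finset.univ
  have e : ∀ z : ZMod 2, z * z = z := by decide
  simp only [hd, one_mul, e] at hs
  simp only [mulVec, dotProduct, Finset.sum_mul] at h0
  simp only [one_mul]
  exact hs.symm.trans h0

/-- In the Neighborhood Lights Out game, the all-ones vector lies in the column space of the
game matrix (`A + A²` if all degrees are odd, `A + A² + I` if all degrees are even or zero);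
hence every state can be inverted. -/
theorem neighborhood_invert_state (n : ℕ)
    (A : Matrix (Fin n) (Fin n) (ZMod 2)) (hsymm : A.IsSymm) (hdiag : ∀ i, A i i = 0) :
    ((∀ i, ∑ j, A i j = 1) →
      ∃ a : Fin n → ZMod 2, (A + A * A).mulVec a = fun _ => 1) ∧
    ((∀ i, ∑ j, A i j = 0) →
      ∃ a : Fin n → ZMod 2, (A + A * A + 1).mulVec a = fun _ => 1) := by
  constructor
  · intro h
    apply ones_mem_zmod2
    · unfold Matrix.IsSymm
      rw [transpose_add, transpose_mul, hsymm.eq]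
    · intro i
      have e : ∀ z : ZMod 2, z * z = z := by decide
      rw [Matrix.add_apply, hdiag, zero_add, Matrix.mul_apply, ← h i]
      refine Finset.sum_congr rfl fun j _ => ?_
      rw [hsymm.apply i j, e]
  · intro h
    refine ⟨fun _ => 1, ?_⟩
    have h1 : A.mulVec (fun _ => 1) = 0 := by
      funext i
      simpa [mulVec, dotProduct] using h i
    rw [add_mulVec, add_mulVec, ← mulVec_mulVec, h1]
    simp
end

section
/- Let N̄ be an arbitrary symmetric n×n matrix over F2 and let d = (N̄_{11}, N̄_{22}, …, N̄_{nn})ᵀ ∈ F2^n be the vector of its diagonal entries. Then d lies in the column space of N̄, i.e., there exists a ∈ F2^n with N̄ a = d. Consequently, in the Non-reflexive Lights Out game with matrix N̄ = A + Ī (A an adjacency matrix, Ī a diagonal matrix), any initial state i can be transformed into any final state f with i + f = d; in particular, starting from all lights off, the state d can be reached. -/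
open Matrix

theorem quad_eq_diag (n : ℕ) (N : Matrix (Fin n) (Fin n) (ZMod 2)) (hs : N.IsSymm)
    (x : Fin n → ZMod 2) : x ⬝ᵥ (N *ᵥ x) = (fun i => N i i) ⬝ᵥ x := by
  have h0 : ∑ p : Fin n × Fin n, (if p.1 = p.2 then 0 else x p.1 * (N p.1 p.2 * x p.2)) = 0 := by
    refine Finset.sum_involution (fun p _ => p.swap) ?_ ?_ ?_ ?_
    · rintro ⟨i, j⟩ -
      by_cases h : i = j
      · simp [h]
      · have h' : ¬ j = i := fun e => h e.symm
        simp only [Prod.swap, h, h', if_false]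
        rw [hs.apply i j, show x j * (N i j * x i) = x i * (N i j * x j) by ring]
        exact CharTwo.add_self_eq_zero _
    · rintro ⟨i, j⟩ - hne he
      apply hne
      simp only [Prod.swap, Prod.mk.injEq] at he
      simp [he.2]
    · intro p _
      exact Finset.mem_univ _
    · intro p _
      exact Prod.swap_swap p
  rw [Fintype.sum_prod_type] at h0
  have h1 : ∀ i, (∑ j, if i = j then 0 else x i * (N i j * x j))
      = x i * (N *ᵥ x) i - N i i * x i := by
    intro i
    have h2 : ∀ j, (if i = j then 0 else x i * (N i j * x j))
        = x i * (N i j * x j) - if i = j then x i * (N i j * x j) else 0 := by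
      intro j
      split_ifs <;> simp
    have h3 : ∀ a b : ZMod 2, a * (b * a) = b * a := by decide
    simp only [h2, Finset.sum_sub_distrib, Finset.sum_ite_eq, Finset.mem_univ, if_true, h3]
    simp [mulVec, dotProduct, Finset.mul_sum]
  simp only [h1, Finset.sum_sub_distrib] at h0
  exact sub_eq_zero.mp h0

theorem diag_mem (n : ℕ) (N : Matrix (Fin n) (Fin n) (ZMod 2)) (hs : N.IsSymm) :
    ∃ a : Fin n → ZMod 2, N *ᵥ a = fun i => N i i := by
  have hm : dotProductBilin (ZMod 2) (ZMod 2) (fun i => N i i) ∈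
      (LinearMap.ker N.mulVecLin).dualAnnihilator := by
    rw [Submodule.mem_dualAnnihilator]
    intro x hx
    have hx' : N *ᵥ x = 0 := hx
    have := quad_eq_diag n N hs x
    rw [hx', dotProduct_zero] at this
    exact this.symm
  rw [← LinearMap.range_dualMap_eq_dualAnnihilator_ker] at hm
  obtain ⟨g, hg⟩ := hm
  refine ⟨fun i => g (Pi.single i 1), ?_⟩
  have key : ∀ y, g y = (fun i => g (Pi.single i 1)) ⬝ᵥ y := by
    intro y
    rw [LinearMap.pi_apply_eq_sum_univ g y]
    simp only [dotProduct, smul_eq_mul]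
    refine Finset.sum_congr rfl fun i _ => ?_
    rw [mul_comm]
    congr 2
    funext j
    simp [Pi.single_apply, eq_comm]
  refine dotProduct_eq _ _ fun x => ?_
  have h := LinearMap.congr_fun hg x
  have h' : g (N *ᵥ x) = (fun i => N i i) ⬝ᵥ x := h
  rw [← h', key, dotProduct_mulVec, ← mulVec_transpose, hs.eq]

/-- For any symmetric matrix `N̄` over 𝔽₂, the vector `d` of its diagonal entries lies in
its column space. Consequently, in the Non-reflexive Lights Out game with matrix `N̄`, any
initial state `i` can be transformed into any final state `f` with `i + f = d`; in
particular, starting from all lights off, the state `d` can be reached. -/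
theorem nonreflexive_diagonal_reachable (n : ℕ)
    (Nbar : Matrix (Fin n) (Fin n) (ZMod 2)) (hsymm : Nbar.IsSymm)
    (d : Fin n → ZMod 2) (hd : d = fun i => Nbar i i) :
    (∃ a : Fin n → ZMod 2, Nbar.mulVec a = d) ∧
    (∀ i f : Fin n → ZMod 2, i + f = d →
      ∃ a : Fin n → ZMod 2, f = i + Nbar.mulVec a) ∧
    (∃ a : Fin n → ZMod 2, d = 0 + Nbar.mulVec a) := by
  obtain ⟨a, ha⟩ := diag_mem n Nbar hsymm
  rw [← hd] at ha
  refine ⟨⟨a, ha⟩, fun i f h => ⟨a, ?_⟩, ⟨a, ?_⟩⟩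
  · rw [ha, ← h]
    funext k
    simp only [Pi.add_apply]
    rw [← add_assoc, CharTwo.add_self_eq_zero, zero_add]
  · rw [ha, zero_add]
end
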